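/- arXiv:2410.22509 — 7 statements merged into one kernel-verified Lean document; each statement's English description precedes it below -/
import Mathlib

section
/- Let (X,d) be a separable metric space and μ a Borel measure on X that is positive on nonempty open sets and finite on bounded sets. Let p : X → [1,∞) be measurable with ess sup p < ∞, and let φ : X → X be a non-singular Borel map with Radon–Nikodym derivative u_φ. Then the following are equivalent: (M1) there exists a constant C > 0 such that ∫_X |f(φ(x))|^{p(x)} dμ ≤ C · ∫_X |f(x)|^{p(x)} dμ for every measurable f : X → ℝ; (M2) u_φ is essentially bounded on X and p(φ(x)) = p(x) for μ-almost every x ∈ X. -/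
open MeasureTheory Metric Filter ENNReal

/-- A constant dominated by arbitrarily small multiples `t ^ c * K` with `K < ∞` vanishes. -/
lemma eq_zero_of_forall_le_rpow_mul {m K : ℝ≥0∞} {c : ℝ} (hc : 0 < c) (hK : K ≠ ∞)
    (h : ∀ t : ℝ, 0 < t → t < 1 → m ≤ ENNReal.ofReal (t ^ c) * K) : m = 0 := by
  have hlim : Tendsto (fun t : ℝ => ENNReal.ofReal (t ^ c) * K) (nhdsWithin 0 (Set.Ioi 0))
      (nhds 0) := by
    have h1 : Tendsto (fun t : ℝ => t ^ c) (nhdsWithin 0 (Set.Ioi 0)) (nhds 0) := by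
      have := (Real.continuousAt_rpow_const 0 c (Or.inr hc.le)).tendsto
      rw [Real.zero_rpow hc.ne'] at this
      exact this.mono_left nhdsWithin_le_nhds
    have h2 := ENNReal.Tendsto.mul_const (ENNReal.tendsto_ofReal h1) (Or.inr hK)
    simpa using h2
  have hev : ∀ᶠ t : ℝ in nhdsWithin 0 (Set.Ioi 0), m ≤ ENNReal.ofReal (t ^ c) * K := by
    filter_upwards [Ioo_mem_nhdsGT (zero_lt_one' ℝ)] with t ht using h t ht.1 ht.2
  exact le_antisymm (ge_of_tendsto hlim hev) zero_le

section

variable {X : Type*} [MeasurableSpace X] {μ : Measure X} {p : X → ℝ} {φ : X → X} {C : ℝ}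

/-- Testing the modular inequality on `T` times an indicator function. -/
lemma ofReal_mul_measure_le_of_modular_le (hp1 : ∀ x, 1 ≤ p x)
    (h : ∀ f : X → ℝ, Measurable f → ∫⁻ x, ENNReal.ofReal |f (φ x)| ^ p x ∂μ ≤
      ENNReal.ofReal C * ∫⁻ x, ENNReal.ofReal |f x| ^ p x ∂μ)
    {E S : Set X} (hE : MeasurableSet E) (hS : MeasurableSet S) (hSE : ∀ x ∈ S, φ x ∈ E)
    {T α β : ℝ} (hT : 0 < T) (hα : ∀ x ∈ S, α ≤ T ^ p x) (hβ : ∀ x ∈ E, T ^ p x ≤ β) :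
    ENNReal.ofReal α * μ S ≤ ENNReal.ofReal C * (ENNReal.ofReal β * μ E) := by
  have key := h (E.indicator fun _ => T) (measurable_const.indicator hE)
  calc ENNReal.ofReal α * μ S
      = ∫⁻ x, S.indicator (fun _ => ENNReal.ofReal α) x ∂μ := by
        rw [lintegral_indicator_const hS]
    _ ≤ ∫⁻ x, ENNReal.ofReal |E.indicator (fun _ => T) (φ x)| ^ p x ∂μ := by
        refine lintegral_mono fun x => ?_
        by_cases hx : x ∈ S
        · rw [Set.indicator_of_mem hx, Set.indicator_of_mem (hSE x hx), abs_of_pos hT,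
            ENNReal.ofReal_rpow_of_pos hT]
          exact ENNReal.ofReal_le_ofReal (hα x hx)
        · simp [hx]
    _ ≤ ENNReal.ofReal C * ∫⁻ x, ENNReal.ofReal |E.indicator (fun _ => T) x| ^ p x ∂μ := key
    _ ≤ ENNReal.ofReal C * ∫⁻ x, E.indicator (fun _ => ENNReal.ofReal β) x ∂μ := by
        gcongr with x
        by_cases hx : x ∈ E
        · rw [Set.indicator_of_mem hx, Set.indicator_of_mem hx, abs_of_pos hT,
            ENNReal.ofReal_rpow_of_pos hT]
          exact ENNReal.ofReal_le_ofReal (hβ x hx)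
        · simp [hx, lt_of_lt_of_le one_pos (hp1 x)]
    _ = ENNReal.ofReal C * (ENNReal.ofReal β * μ E) := by
        rw [lintegral_indicator_const hE]

lemma measure_preimage_le_of_modular_le (hφ : Measurable φ) (hp1 : ∀ x, 1 ≤ p x)
    (h : ∀ f : X → ℝ, Measurable f → ∫⁻ x, ENNReal.ofReal |f (φ x)| ^ p x ∂μ ≤
      ENNReal.ofReal C * ∫⁻ x, ENNReal.ofReal |f x| ^ p x ∂μ)
    {E : Set X} (hE : MeasurableSet E) : μ (φ ⁻¹' E) ≤ ENNReal.ofReal C * μ E := by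
  simpa using ofReal_mul_measure_le_of_modular_le hp1 h hE (hφ hE) (fun _ hx => hx) one_pos
    (α := 1) (β := 1) (by simp) (by simp)

lemma measure_eq_zero_of_modular_le_of_lt (hp1 : ∀ x, 1 ≤ p x)
    (h : ∀ f : X → ℝ, Measurable f → ∫⁻ x, ENNReal.ofReal |f (φ x)| ^ p x ∂μ ≤
      ENNReal.ofReal C * ∫⁻ x, ENNReal.ofReal |f x| ^ p x ∂μ)
    {E S : Set X} (hE : MeasurableSet E) (hS : MeasurableSet S) (hSE : ∀ x ∈ S, φ x ∈ E)
    (hμE : μ E ≠ ∞) {a b : ℝ} (hab : a < b)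
    (hp : (∀ x ∈ S, b ≤ p x) ∧ (∀ x ∈ E, p x ≤ a) ∨ (∀ x ∈ S, p x ≤ a) ∧ (∀ x ∈ E, b ≤ p x)) :
    μ S = 0 := by
  refine eq_zero_of_forall_le_rpow_mul (sub_pos.2 hab)
    (ENNReal.mul_ne_top (ENNReal.ofReal_ne_top (r := C)) hμE) fun t ht0 ht1 => ?_
  have cancel : ∀ α β : ℝ, 0 < α → β = α * t ^ (b - a) →
      ENNReal.ofReal α * μ S ≤ ENNReal.ofReal C * (ENNReal.ofReal β * μ E) →
      μ S ≤ ENNReal.ofReal (t ^ (b - a)) * (ENNReal.ofReal C * μ E) := by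
    rintro α β hα rfl hle
    rw [ENNReal.ofReal_mul hα.le] at hle
    refine (ENNReal.mul_le_mul_iff_right (ENNReal.ofReal_pos.2 hα).ne' ENNReal.ofReal_ne_top).1
      (hle.trans_eq ?_)
    ring
  rcases hp with ⟨hpS, hpE⟩ | ⟨hpS, hpE⟩
  · have ht1' : 1 ≤ t⁻¹ := (one_lt_inv₀ ht0).2 ht1 |>.le
    refine cancel (t⁻¹ ^ b) (t⁻¹ ^ a) (by positivity) ?_
      (ofReal_mul_measure_le_of_modular_le hp1 h hE hS hSE (inv_pos.2 ht0)
        (fun x hx => Real.rpow_le_rpow_of_exponent_le ht1' (hpS x hx))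
        (fun x hx => Real.rpow_le_rpow_of_exponent_le ht1' (hpE x hx)))
    rw [Real.inv_rpow ht0.le, Real.inv_rpow ht0.le, ← Real.rpow_neg ht0.le,
      ← Real.rpow_neg ht0.le, ← Real.rpow_add ht0]
    ring_nf
  · refine cancel (t ^ a) (t ^ b) (by positivity) ?_
      (ofReal_mul_measure_le_of_modular_le hp1 h hE hS hSE ht0
        (fun x hx => Real.rpow_le_rpow_of_exponent_ge ht0 ht1.le (hpS x hx))
        (fun x hx => Real.rpow_le_rpow_of_exponent_ge ht0 ht1.le (hpE x hx)))
    rw [← Real.rpow_add ht0]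
    ring_nf

lemma ae_comp_eq_of_modular_le [SigmaFinite μ] (hφ : Measurable φ) (hp_meas : Measurable p)
    (hp1 : ∀ x, 1 ≤ p x)
    (h : ∀ f : X → ℝ, Measurable f → ∫⁻ x, ENNReal.ofReal |f (φ x)| ^ p x ∂μ ≤
      ENNReal.ofReal C * ∫⁻ x, ENNReal.ofReal |f x| ^ p x ∂μ) :
    ∀ᵐ x ∂μ, p (φ x) = p x := by
  have hle (a : ℝ) : MeasurableSet {x | p x ≤ a} := measurableSet_le hp_meas measurable_const
  have hge (b : ℝ) : MeasurableSet {x | b ≤ p x} := measurableSet_le measurable_const hp_meas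
  have hfin (n : ℕ) (A : Set X) : μ (spanningSets μ n ∩ A) ≠ ∞ :=
    ((measure_mono Set.inter_subset_left).trans_lt (measure_spanningSets_lt_top μ n)).ne
  have hgt : ∀ a b : ℚ, a < b → ∀ n : ℕ,
      ∀ᵐ x ∂μ, ¬ (φ x ∈ spanningSets μ n ∩ {y | p y ≤ a} ∧ (b : ℝ) ≤ p x) := by
    intro a b hab n
    have hE := (measurableSet_spanningSets μ n).inter (hle a)
    rw [ae_iff]
    simp only [not_not]
    exact measure_eq_zero_of_modular_le_of_lt hp1 h hE ((hφ hE).inter (hge b)) (fun x hx => hx.1)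
      (hfin n _) (Rat.cast_lt.2 hab) (Or.inl ⟨fun x hx => hx.2, fun x hx => hx.2⟩)
  have hlt : ∀ a b : ℚ, a < b → ∀ n : ℕ,
      ∀ᵐ x ∂μ, ¬ (φ x ∈ spanningSets μ n ∩ {y | (b : ℝ) ≤ p y} ∧ p x ≤ a) := by
    intro a b hab n
    have hE := (measurableSet_spanningSets μ n).inter (hge b)
    rw [ae_iff]
    simp only [not_not]
    exact measure_eq_zero_of_modular_le_of_lt hp1 h hE ((hφ hE).inter (hle a)) (fun x hx => hx.1)
      (hfin n _) (Rat.cast_lt.2 hab) (Or.inr ⟨fun x hx => hx.2, fun x hx => hx.2⟩)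
  simp only [← ae_all_iff] at hgt hlt
  filter_upwards [hgt, hlt] with x hx_gt hx_lt
  have hmem := mem_spanningSetsIndex μ (φ x)
  rcases lt_trichotomy (p (φ x)) (p x) with hx | hx | hx
  · obtain ⟨a, ha, ha'⟩ := exists_rat_btwn hx
    obtain ⟨b, hb, hb'⟩ := exists_rat_btwn ha'
    exact absurd ⟨⟨hmem, ha.le⟩, hb'.le⟩ (hx_gt a b (Rat.cast_lt.1 hb) _)
  · exact hx
  · obtain ⟨a, ha, ha'⟩ := exists_rat_btwn hx
    obtain ⟨b, hb, hb'⟩ := exists_rat_btwn ha'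
    exact absurd ⟨⟨hmem, hb'.le⟩, ha.le⟩ (hx_lt a b (Rat.cast_lt.1 hb) _)

end

/-- Let `(X,d)` be a separable metric space and `μ` a Borel measure on `X` that is positive
on nonempty open sets and finite on bounded sets. Let `p : X → [1,∞)` be measurable with
`ess sup p < ∞`, and let `φ : X → X` be a non-singular Borel map with Radon–Nikodym
derivative `u`. Then the following are equivalent:
(M1) there is `C > 0` with `∫ |f(φ x)|^{p x} dμ ≤ C ∫ |f x|^{p x} dμ` for every measurable `f`;
(M2) `u` is essentially bounded and `p (φ x) = p x` for `μ`-a.e. `x`. -/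
theorem statement0
    {X : Type*} [MetricSpace X] [TopologicalSpace.SeparableSpace X]
    [MeasurableSpace X] [BorelSpace X]
    (μ : Measure X) [μ.IsOpenPosMeasure]
    (hfin : ∀ s : Set X, Bornology.IsBounded s → μ s < ∞)
    (p : X → ℝ) (hp_meas : Measurable p) (hp1 : ∀ x, 1 ≤ p x)
    (P : ℝ) (hP : ∀ᵐ x ∂μ, p x ≤ P)
    (φ : X → X) (hφ : Measurable φ)
    (hns : ∀ E : Set X, MeasurableSet E → μ E = 0 → μ (φ ⁻¹' E) = 0)
    (u : X → ℝ≥0∞) (hu_meas : Measurable u)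
    (hu : ∀ E : Set X, MeasurableSet E → μ (φ ⁻¹' E) = ∫⁻ x in E, u x ∂μ) :
    (∃ C : ℝ, 0 < C ∧ ∀ f : X → ℝ, Measurable f →
        ∫⁻ x, ENNReal.ofReal |f (φ x)| ^ p x ∂μ ≤
          ENNReal.ofReal C * ∫⁻ x, ENNReal.ofReal |f x| ^ p x ∂μ) ↔
      ((∃ M : ℝ, ∀ᵐ x ∂μ, u x ≤ ENNReal.ofReal M) ∧ (∀ᵐ x ∂μ, p (φ x) = p x)) := by
  have : IsLocallyFiniteMeasure μ :=
    ⟨fun x => ⟨ball x 1, ball_mem_nhds x one_pos, hfin _ isBounded_ball⟩⟩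
  have : SecondCountableTopology X := UniformSpace.secondCountable_of_separable X
  constructor
  · rintro ⟨C, -, h⟩
    refine ⟨⟨C, ?_⟩, ae_comp_eq_of_modular_le hφ hp_meas hp1 h⟩
    refine ae_le_of_forall_setLIntegral_le_of_sigmaFinite hu_meas fun E hE _ => ?_
    rw [← hu E hE, setLIntegral_const]
    exact measure_preimage_le_of_modular_le hφ hp1 h hE
  · rintro ⟨⟨M, hM⟩, hpφ⟩
    refine ⟨max M 1, by positivity, fun f hf => ?_⟩
    have hmap : μ.map φ = μ.withDensity u := by
      ext E hE
      rw [Measure.map_apply hφ hE, withDensity_apply u hE, hu E hE]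
    have hg : Measurable fun x => ENNReal.ofReal |f x| ^ p x :=
      (ENNReal.measurable_ofReal.comp hf.abs).pow hp_meas
    calc ∫⁻ x, ENNReal.ofReal |f (φ x)| ^ p x ∂μ
        = ∫⁻ x, ENNReal.ofReal |f (φ x)| ^ p (φ x) ∂μ :=
          lintegral_congr_ae (by filter_upwards [hpφ] with x hx; rw [hx])
      _ = ∫⁻ x, u x * ENNReal.ofReal |f x| ^ p x ∂μ := by
          rw [← lintegral_map hg hφ, hmap, lintegral_withDensity_eq_lintegral_mul μ hu_meas hg]
          rfl
      _ ≤ ∫⁻ x, ENNReal.ofReal (max M 1) * ENNReal.ofReal |f x| ^ p x ∂μ := by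
          refine lintegral_mono_ae ?_
          filter_upwards [hM] with x hx
          gcongr
          exact hx.trans (ENNReal.ofReal_le_ofReal (le_max_left _ _))
      _ = ENNReal.ofReal (max M 1) * ∫⁻ x, ENNReal.ofReal |f x| ^ p x ∂μ :=
          lintegral_const_mul _ hg
end

section
/- Let (X,d) be a separable metric space and μ an Ahlfors Q-regular Borel measure on X. Let p : X → [1,∞) be measurable, locally log-Hölder continuous, with ess sup p < ∞, and let φ : X → X be a non-singular Borel map such that p⁻_{φ⁻¹(B)} ≥ p⁻_B for every open ball B. If there is a constant C > 0 with ‖f∘φ‖_{p(·)} ≤ C‖f‖_{p(·)} for all f ∈ L^{p(·)}(X), then there exists a constant C' > 0 such that μ(φ⁻¹(B)) ≤ C' · μ(B) for every open ball B ⊆ X. -/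
open MeasureTheory Metric Filter ENNReal

/-- The Luxemburg norm associated with a variable exponent `p`
(with the convention `inf ∅ = ∞`). -/
noncomputable def luxNorm {X : Type*} [MeasurableSpace X]
    (μ : Measure X) (p : X → ℝ) (f : X → ℝ) : ℝ≥0∞ :=
  sInf {η : ℝ≥0∞ | ∫⁻ x, (ENNReal.ofReal |f x| / η) ^ p x ∂μ ≤ 1}

/-- Membership in the variable exponent Lebesgue space `L^{p(·)}(X)`. -/
def MemVarLp {X : Type*} [MeasurableSpace X]
    (μ : Measure X) (p : X → ℝ) (f : X → ℝ) : Prop :=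
  Measurable f ∧ ∃ η : ℝ, 0 < η ∧ ∫⁻ x, ENNReal.ofReal (|f x| / η) ^ p x ∂μ < ∞

section VariableExponent

variable {X : Type*} [MeasurableSpace X] {μ : Measure X} {p : X → ℝ} {S : Set X}

theorem lintegral_indicator_one_div_exp_rpow (hp : ∀ x, 0 < p x) (hS : MeasurableSet S) (τ : ℝ) :
    ∫⁻ x, (ENNReal.ofReal |S.indicator 1 x| / ENNReal.ofReal (Real.exp τ)) ^ p x ∂μ =
      ∫⁻ x in S, ENNReal.ofReal (Real.exp (-τ * p x)) ∂μ := by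
  rw [← lintegral_indicator hS]
  congr 1 with x
  by_cases hx : x ∈ S
  · rw [Set.indicator_of_mem hx, Set.indicator_of_mem hx, Pi.one_apply, abs_one,
      ← ENNReal.ofReal_div_of_pos (Real.exp_pos τ),
      ENNReal.ofReal_rpow_of_pos (by positivity), one_div, ← Real.exp_neg, ← Real.exp_mul]
  · simp [Set.indicator_of_notMem hx, ENNReal.zero_rpow_of_pos (hp x)]

theorem luxNorm_indicator_le (hp : ∀ x, 0 < p x) (hS : MeasurableSet S) {τ : ℝ}
    (h : ∫⁻ x in S, ENNReal.ofReal (Real.exp (-τ * p x)) ∂μ ≤ 1) :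
    luxNorm μ p (S.indicator 1) ≤ ENNReal.ofReal (Real.exp τ) :=
  sInf_le ((lintegral_indicator_one_div_exp_rpow hp hS τ).trans_le h)

theorem lintegral_exp_le_one_of_luxNorm_indicator_lt (hp : ∀ x, 0 < p x) (hS : MeasurableSet S)
    {τ : ℝ} (h : luxNorm μ p (S.indicator 1) < ENNReal.ofReal (Real.exp τ)) :
    ∫⁻ x in S, ENNReal.ofReal (Real.exp (-τ * p x)) ∂μ ≤ 1 := by
  obtain ⟨η, hη, hlt⟩ := sInf_lt_iff.1 h
  rw [← lintegral_indicator_one_div_exp_rpow hp hS]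
  refine le_trans (lintegral_mono fun x => ?_) hη
  have := (hp x).le
  dsimp only
  gcongr

theorem memVarLp_indicator (hp : ∀ x, 0 < p x) (hS : MeasurableSet S) {τ : ℝ}
    (h : ∫⁻ x in S, ENNReal.ofReal (Real.exp (-τ * p x)) ∂μ ≤ 1) :
    MemVarLp μ p (S.indicator 1) := by
  refine ⟨measurable_one.indicator hS, Real.exp τ, Real.exp_pos τ, ?_⟩
  simp_rw [ENNReal.ofReal_div_of_pos (Real.exp_pos τ)]
  rw [lintegral_indicator_one_div_exp_rpow hp hS]
  exact h.trans_lt ENNReal.one_lt_top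

/-- A lower bound for `p` on a non-null set `B` passes to any set with larger essential infimum. -/
theorem ae_restrict_le_of_essInf_le {B E : Set X} {a b m : ℝ} (hB : μ B ≠ 0)
    (hBm : MeasurableSet B) (ha : ∀ x ∈ B, a ≤ p x) (hb : ∀ x ∈ B, p x ≤ b) (hm : ∀ x, m ≤ p x)
    (h : essInf p (μ.restrict B) ≤ essInf p (μ.restrict E)) :
    ∀ᵐ x ∂μ.restrict E, a ≤ p x := by
  have hne : (ae (μ.restrict B)).NeBot := by
    rw [ae_neBot]
    simpa using hB
  have hlow : a ≤ essInf p (μ.restrict B) :=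
    le_essInf_of_ae_le a (ae_restrict_of_forall_mem hBm ha)
      (isCoboundedUnder_ge_of_eventually_le _ (ae_restrict_of_forall_mem hBm hb))
  have hE : ∀ᵐ x ∂μ.restrict E, essInf p (μ.restrict E) ≤ p x :=
    ae_essInf_le ⟨m, eventually_map.2 (Eventually.of_forall hm)⟩
  filter_upwards [hE] with x hx
  linarith

end VariableExponent

/-- Vitali covering comparison: if on small balls `ν` is bounded above and `μ` bounded below by
multiples of `r ^ Q`, then `ν` is bounded by a multiple of `μ` on all open sets. -/
theorem measure_open_le_of_small_balls {X : Type*} [MetricSpace X]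
    [TopologicalSpace.SeparableSpace X] [MeasurableSpace X] [BorelSpace X]
    {μ ν : Measure X} {Q c D r₀ : ℝ} (hc : 0 < c) (hD : 0 < D) (hr₀ : 0 < r₀)
    (hμ : ∀ x r, 0 < r → r ≤ r₀ → ENNReal.ofReal (c * r ^ Q) ≤ μ (ball x r))
    (hν : ∀ x r, 0 < r → r ≤ r₀ → ν (ball x r) ≤ ENNReal.ofReal (D * r ^ Q))
    {U : Set X} (hU : IsOpen U) :
    ν U ≤ ENNReal.ofReal (D * 6 ^ Q / c) * μ U := by
  have hex : ∀ x ∈ U, ∃ ρ, 0 < ρ ∧ ρ ≤ r₀ / 6 ∧ closedBall x ρ ⊆ U := by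
    intro x hx
    obtain ⟨ε, hε, h⟩ := Metric.nhds_basis_closedBall.mem_iff.1 (hU.mem_nhds hx)
    exact ⟨min ε (r₀ / 6), by positivity, min_le_right _ _,
      (closedBall_subset_closedBall (min_le_left _ _)).trans h⟩
  choose! ρ hρ hρr hρU using hex
  obtain ⟨u, huU, hdisj, hcov⟩ := Vitali.exists_disjoint_subfamily_covering_enlargement_closedBall
    U (fun x => x) ρ (r₀ / 6) hρr 5 (by norm_num)
  have hcount : u.Countable := hdisj.countable_of_nonempty_interior fun x hx =>
    (nonempty_ball.2 (hρ x (huU hx))).mono ball_subset_interior_closedBall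
  have hsub : U ⊆ ⋃ x ∈ u, closedBall x (5 * ρ x) := by
    intro x hx
    obtain ⟨b, hb, h⟩ := hcov x hx
    exact Set.mem_biUnion hb (h (mem_closedBall_self (hρ x hx).le))
  have hball : ∀ x ∈ u, ν (closedBall x (5 * ρ x)) ≤
      ENNReal.ofReal (D * 6 ^ Q / c) * μ (closedBall x (ρ x)) := by
    intro x hx
    have h0 := hρ x (huU hx)
    have h1 := hρr x (huU hx)
    calc ν (closedBall x (5 * ρ x)) ≤ ν (ball x (6 * ρ x)) := by
          gcongr
          exact closedBall_subset_ball (by linarith)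
      _ ≤ ENNReal.ofReal (D * (6 * ρ x) ^ Q) := hν x _ (by linarith) (by linarith)
      _ = ENNReal.ofReal (D * 6 ^ Q / c) * ENNReal.ofReal (c * ρ x ^ Q) := by
          rw [← ENNReal.ofReal_mul (by positivity), Real.mul_rpow (by norm_num) h0.le]
          congr 1
          field_simp
      _ ≤ ENNReal.ofReal (D * 6 ^ Q / c) * μ (closedBall x (ρ x)) := by
          gcongr
          exact (hμ x _ h0 (by linarith)).trans (measure_mono ball_subset_closedBall)
  calc ν U ≤ ν (⋃ x ∈ u, closedBall x (5 * ρ x)) := measure_mono hsub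
    _ ≤ ∑' x : u, ν (closedBall (x : X) (5 * ρ x)) := measure_biUnion_le ν hcount _
    _ ≤ ∑' x : u, ENNReal.ofReal (D * 6 ^ Q / c) * μ (closedBall (x : X) (ρ x)) :=
        ENNReal.tsum_le_tsum fun x => hball x x.2
    _ = ENNReal.ofReal (D * 6 ^ Q / c) * μ (⋃ x ∈ u, closedBall x (ρ x)) := by
        rw [ENNReal.tsum_mul_left, measure_biUnion hcount hdisj fun x _ => measurableSet_closedBall]
    _ ≤ ENNReal.ofReal (D * 6 ^ Q / c) * μ U := by
        gcongr
        exact Set.iUnion₂_subset fun x hx => hρU x (huU hx)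

/-- If the exponent oscillates by at most `ω` around `s - ω` on `B`, and `μ B ≤ exp (-(s * t))`,
boundedness of the composition operator controls the measure of the preimage of `B`. -/
theorem measure_preimage_le_of_luxNorm_comp_le {X : Type*} [MeasurableSpace X]
    {μ : Measure X} {p : X → ℝ} {P C₀ q ω t : ℝ} {φ : X → X} {B : Set X}
    (hp1 : ∀ x, 1 ≤ p x) (hP : ∀ᵐ x ∂μ, p x ≤ P) (hφ : Measurable φ) (hC₀ : 0 < C₀)
    (hbound : ∀ f : X → ℝ, MemVarLp μ p f →
      luxNorm μ p (fun x => f (φ x)) ≤ ENNReal.ofReal C₀ * luxNorm μ p f)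
    (hBm : MeasurableSet B) (hB : μ B ≠ 0)
    (hinf : essInf p (μ.restrict B) ≤ essInf p (μ.restrict (φ ⁻¹' B)))
    (ht : 0 ≤ t) (hlow : ∀ x ∈ B, q - ω ≤ p x) (hup : ∀ x ∈ B, p x ≤ q + ω)
    (hμB : μ B ≤ ENNReal.ofReal (Real.exp (-((q + ω) * t)))) :
    μ (φ ⁻¹' B) ≤ ENNReal.ofReal (Real.exp (Real.log (C₀ + 1) * P - (q - ω) * t)) := by
  have hp0 : ∀ x, 0 < p x := fun x => zero_lt_one.trans_le (hp1 x)
  have hone : ∫⁻ x in B, ENNReal.ofReal (Real.exp (- -t * p x)) ∂μ ≤ 1 := by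
    calc ∫⁻ x in B, ENNReal.ofReal (Real.exp (- -t * p x)) ∂μ
        ≤ ∫⁻ _ in B, ENNReal.ofReal (Real.exp ((q + ω) * t)) ∂μ := by
          refine setLIntegral_mono' hBm fun x hx => ?_
          refine ENNReal.ofReal_le_ofReal (Real.exp_le_exp.2 ?_)
          nlinarith [mul_le_mul_of_nonneg_left (hup x hx) ht]
      _ = ENNReal.ofReal (Real.exp ((q + ω) * t)) * μ B := by simp
      _ ≤ ENNReal.ofReal (Real.exp ((q + ω) * t)) *
          ENNReal.ofReal (Real.exp (-((q + ω) * t))) := by gcongr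
      _ = 1 := by
          rw [← ENNReal.ofReal_mul (Real.exp_pos _).le, ← Real.exp_add]
          simp
  have hk : 0 ≤ Real.log (C₀ + 1) := Real.log_nonneg (by linarith)
  have hlt : luxNorm μ p ((φ ⁻¹' B).indicator 1) <
      ENNReal.ofReal (Real.exp (Real.log (C₀ + 1) - t)) := by
    calc luxNorm μ p ((φ ⁻¹' B).indicator 1)
        = luxNorm μ p (fun x => B.indicator 1 (φ x)) := rfl
      _ ≤ ENNReal.ofReal C₀ * luxNorm μ p (B.indicator 1) :=
          hbound (B.indicator 1) (memVarLp_indicator hp0 hBm hone)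
      _ ≤ ENNReal.ofReal C₀ * ENNReal.ofReal (Real.exp (-t)) := by
          gcongr
          exact luxNorm_indicator_le hp0 hBm hone
      _ < ENNReal.ofReal (Real.exp (Real.log (C₀ + 1) - t)) := by
          rw [← ENNReal.ofReal_mul hC₀.le, sub_eq_add_neg, Real.exp_add,
            Real.exp_log (by linarith), ENNReal.ofReal_lt_ofReal_iff (by positivity)]
          nlinarith [Real.exp_pos (-t)]
  have hE := lintegral_exp_le_one_of_luxNorm_indicator_lt hp0 (hφ hBm) hlt
  have hpE := ae_restrict_le_of_essInf_le hB hBm hlow hup hp1 hinf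
  set M := Real.log (C₀ + 1) * P - (q - ω) * t with hM
  have hmul : ENNReal.ofReal (Real.exp (-M)) * μ (φ ⁻¹' B) ≤ 1 := by
    calc ENNReal.ofReal (Real.exp (-M)) * μ (φ ⁻¹' B)
        = ∫⁻ _ in φ ⁻¹' B, ENNReal.ofReal (Real.exp (-M)) ∂μ := by simp
      _ ≤ ∫⁻ x in φ ⁻¹' B,
          ENNReal.ofReal (Real.exp (-(Real.log (C₀ + 1) - t) * p x)) ∂μ := by
          refine lintegral_mono_ae ?_
          filter_upwards [hpE, ae_restrict_of_ae hP] with x h1 h2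
          refine ENNReal.ofReal_le_ofReal (Real.exp_le_exp.2 ?_)
          linarith [mul_le_mul_of_nonneg_left h1 ht, mul_le_mul_of_nonneg_left h2 hk]
      _ ≤ 1 := hE
  calc μ (φ ⁻¹' B)
      = ENNReal.ofReal (Real.exp M) * (ENNReal.ofReal (Real.exp (-M)) * μ (φ ⁻¹' B)) := by
        rw [← mul_assoc, ← ENNReal.ofReal_mul (Real.exp_pos _).le, ← Real.exp_add]
        simp
    _ ≤ ENNReal.ofReal (Real.exp M) * 1 := by gcongr
    _ = ENNReal.ofReal (Real.exp M) := mul_one _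

/-- Local log-Hölder continuity controls the oscillation of `p` on balls of radius `r < 1 / 2`. -/
theorem abs_sub_le_div_neg_log_of_mem_ball {X : Type*} [MetricSpace X] {p : X → ℝ} {K₀ : ℝ}
    (hLH0 : ∀ x y : X, 0 < dist x y → dist x y < 1 / 2 →
      |p x - p y| ≤ K₀ / (-Real.log (dist x y)))
    {v x : X} {r : ℝ} (hr2 : r < 1 / 2) (hx : x ∈ ball v r) :
    |p x - p v| ≤ |K₀| / (-Real.log r) := by
  have hxr : dist x v < r := hx
  have hr : 0 < r := dist_nonneg.trans_lt hxr
  have hL : 0 < -Real.log r := neg_pos.2 (Real.log_neg hr (by linarith))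
  rcases eq_or_lt_of_le (dist_nonneg (x := x) (y := v)) with h | h
  · rw [eq_of_dist_eq_zero h.symm, sub_self, abs_zero]
    positivity
  · refine (hLH0 x v h (by linarith)).trans ?_
    have := Real.log_le_log h hxr.le
    gcongr
    exact le_abs_self _

/-- On a separable metric space with an Ahlfors `Q`-regular measure, if `p` is measurable,
locally log-Hölder continuous, essentially bounded, and `φ` is a non-singular Borel map with
`p⁻_{φ⁻¹(B)} ≥ p⁻_B` (essential infima) for every open ball `B`, and the composition operator
`f ↦ f ∘ φ` is bounded on `L^{p(·)}(X)` with constant `C`, then there is `C' > 0` with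
`μ(φ⁻¹(B)) ≤ C'·μ(B)` for every open ball `B`. -/
theorem statement5
    {X : Type*} [MetricSpace X] [TopologicalSpace.SeparableSpace X]
    [MeasurableSpace X] [BorelSpace X]
    (μ : Measure X) (Q c C : ℝ) (hQ : 0 < Q) (hc : 0 < c) (hC : 0 < C)
    (hAhlfors : ∀ (x : X) (r : ℝ), 0 < r →
      ENNReal.ofReal r ≤ EMetric.diam (Set.univ : Set X) →
      ENNReal.ofReal (c * r ^ Q) ≤ μ (ball x r) ∧ μ (ball x r) ≤ ENNReal.ofReal (C * r ^ Q))
    (p : X → ℝ) (hp_meas : Measurable p) (hp1 : ∀ x, 1 ≤ p x)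
    (K₀ : ℝ)
    (hLH0 : ∀ x y : X, 0 < dist x y → dist x y < 1 / 2 →
      |p x - p y| ≤ K₀ / (-Real.log (dist x y)))
    (P : ℝ) (hP : ∀ᵐ x ∂μ, p x ≤ P)
    (φ : X → X) (hφ : Measurable φ)
    (hns : ∀ E : Set X, MeasurableSet E → μ E = 0 → μ (φ ⁻¹' E) = 0)
    (hinf : ∀ (v : X) (r : ℝ), 0 < r →
      essInf p (μ.restrict (ball v r)) ≤ essInf p (μ.restrict (φ ⁻¹' ball v r)))
    (C₀ : ℝ) (hC₀ : 0 < C₀)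
    (hbound : ∀ f : X → ℝ, MemVarLp μ p f →
      luxNorm μ p (fun x => f (φ x)) ≤ ENNReal.ofReal C₀ * luxNorm μ p f) :
    ∃ C' : ℝ, 0 < C' ∧ ∀ (v : X) (r : ℝ), 0 < r →
      μ (φ ⁻¹' ball v r) ≤ ENNReal.ofReal C' * μ (ball v r) := by
  have htriv : (∀ v r, 0 < r → ball v r = (Set.univ : Set X)) →
      ∃ C' : ℝ, 0 < C' ∧ ∀ (v : X) (r : ℝ), 0 < r →
        μ (φ ⁻¹' ball v r) ≤ ENNReal.ofReal C' * μ (ball v r) := fun h =>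
    ⟨1, one_pos, fun v r hr => by simp [h v r hr]⟩
  rcases subsingleton_or_nontrivial X with hX | hX
  · refine htriv fun v r hr => Set.eq_univ_of_forall fun x => ?_
    rw [Subsingleton.elim x v]
    exact mem_ball_self hr
  obtain ⟨x₀, y₀, hxy⟩ := exists_pair_ne X
  have hd₀ : 0 < dist x₀ y₀ := dist_pos.2 hxy
  -- below this radius all the logarithmic estimates are available
  set r₀ := min (dist x₀ y₀) (min (Real.exp (-1)) (Real.exp (-(|Real.log C| / Q))))
  have hr₀pos : 0 < r₀ := by positivity
  have hdiam : ∀ r, r ≤ r₀ → ENNReal.ofReal r ≤ ediam (Set.univ : Set X) := by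
    intro r hr
    calc ENNReal.ofReal r ≤ ENNReal.ofReal (dist x₀ y₀) :=
          ENNReal.ofReal_le_ofReal (hr.trans (min_le_left _ _))
      _ = edist x₀ y₀ := (edist_dist _ _).symm
      _ ≤ _ := Metric.edist_le_ediam_of_mem (Set.mem_univ _) (Set.mem_univ _)
  set D := Real.exp (Real.log (C₀ + 1) * P + 2 * |K₀| * (Q + |Real.log C|)) * C with hDdef
  have hD : 0 < D := by positivity
  have hsmall : ∀ v r, 0 < r → r ≤ r₀ → μ.map φ (ball v r) ≤ ENNReal.ofReal (D * r ^ Q) := by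
    intro v r hr hrr
    obtain ⟨hlo, hhi⟩ := hAhlfors v r hr (hdiam r hrr)
    set L := -Real.log r with hL
    have hL1 : 1 ≤ L := by
      have := Real.log_le_log hr (hrr.trans ((min_le_right _ _).trans (min_le_left _ _)))
      rw [Real.log_exp] at this
      linarith
    have hLQ : |Real.log C| ≤ Q * L := by
      have := Real.log_le_log hr (hrr.trans ((min_le_right _ _).trans (min_le_right _ _)))
      rw [Real.log_exp] at this
      have h2 : |Real.log C| / Q ≤ L := by linarith
      rwa [div_le_iff₀ hQ, mul_comm] at h2
    have hr2 : r < 1 / 2 := by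
      have h1 := hrr.trans ((min_le_right _ _).trans (min_le_left _ _))
      have h2 := Real.exp_neg_one_lt_half
      linarith
    set ω := |K₀| / L with hω
    have hω0 : 0 ≤ ω := by positivity
    have hs1 : 1 ≤ p v + ω := by linarith [hp1 v]
    set t := (Q * L - Real.log C) / (p v + ω) with ht
    have hT : 0 ≤ Q * L - Real.log C := by linarith [le_abs_self (Real.log C)]
    have ht0 : 0 ≤ t := by positivity
    have hst : (p v + ω) * t = Q * L - Real.log C := by
      rw [ht]
      field_simp
    have hCr : C * r ^ Q = Real.exp (-((p v + ω) * t)) := by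
      rw [hst, Real.rpow_def_of_pos hr, ← Real.exp_log hC, ← Real.exp_add, Real.log_exp]
      congr 1
      ring
    have hωt : ω * t ≤ |K₀| * (Q + |Real.log C|) := by
      have h1 : t ≤ L * (Q + |Real.log C|) := by
        calc t ≤ Q * L - Real.log C := div_le_self hT hs1
          _ ≤ L * (Q + |Real.log C|) := by
            nlinarith [neg_abs_le (Real.log C), abs_nonneg (Real.log C)]
      calc ω * t ≤ ω * (L * (Q + |Real.log C|)) := by gcongr
        _ = |K₀| * (Q + |Real.log C|) := by
          rw [hω]
          field_simp
    have hosc : ∀ x ∈ ball v r, |p x - p v| ≤ ω := fun x hx =>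
      abs_sub_le_div_neg_log_of_mem_ball hLH0 hr2 hx
    have hpos : μ (ball v r) ≠ 0 :=
      (lt_of_lt_of_le (ENNReal.ofReal_pos.2 (by positivity)) hlo).ne'
    rw [Measure.map_apply hφ measurableSet_ball]
    refine (measure_preimage_le_of_luxNorm_comp_le hp1 hP hφ hC₀ hbound measurableSet_ball hpos
      (hinf v r hr) ht0 (fun x hx => ?_) (fun x hx => ?_) (hhi.trans_eq (by rw [hCr]))).trans ?_
    · linarith [(abs_le.1 (hosc x hx)).1]
    · linarith [(abs_le.1 (hosc x hx)).2]
    · refine ENNReal.ofReal_le_ofReal ?_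
      rw [hDdef, mul_assoc, hCr, ← Real.exp_add, Real.exp_le_exp]
      linarith
  refine ⟨D * 6 ^ Q / c, by positivity, fun v r hr => ?_⟩
  rw [← Measure.map_apply hφ measurableSet_ball]
  exact measure_open_le_of_small_balls hc hD hr₀pos
    (fun x r hr hrr => (hAhlfors x r hr (hdiam r hrr)).1) hsmall isOpen_ball
end

section
/- Let (X,d) be a separable metric space, μ an Ahlfors Q-regular Borel measure on X, φ : X → X a non-singular Borel map, and p : X → [1,∞) locally log-Hölder continuous such that inf_{x∈φ⁻¹(B)} p(x) ≥ inf_{x∈B} p(x) for every open ball B. Then there exists a constant C₀ > 0 such that for every measurable set A with μ(A) > 0 and every open ball B with A ∩ B ≠ ∅ and μ(B) < 1, one has μ(B)^{1 − p(x)/p(φ(x))} ≥ C₀ for every x ∈ φ⁻¹(A ∩ B). -/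
open MeasureTheory Metric Filter ENNReal

/-- A local log-Hölder estimate at `z` bounds the oscillation of `p` on small balls at `z`. -/
lemma exists_ball_abs_sub_le_of_logHolder {X : Type*} [MetricSpace X] {p : X → ℝ} {K : ℝ} {z : X}
    (hp : ∀ y, 0 < dist z y → dist z y < 1 / 2 → |p z - p y| ≤ K / (-Real.log (dist z y)))
    {ε : ℝ} (hε : 0 < ε) :
    ∃ r : ℝ, 0 < r ∧ ∀ y ∈ ball z r, |p z - p y| ≤ ε := by
  refine ⟨Real.exp (-(|K| / ε + 1)), Real.exp_pos _, fun y hy => ?_⟩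
  rw [mem_ball'] at hy
  rcases (dist_nonneg (x := z) (y := y)).eq_or_lt with h0 | h0
  · rw [dist_eq_zero.mp h0.symm]
    simpa using hε.le
  have hK : 0 ≤ |K| / ε := by positivity
  have hlog : |K| / ε + 1 < -Real.log (dist z y) := by
    linarith [(Real.log_lt_iff_lt_exp h0).mpr hy]
  have hlt : dist z y < 1 / 2 :=
    calc dist z y < Real.exp (-(|K| / ε + 1)) := hy
      _ ≤ Real.exp (-1) := Real.exp_le_exp.mpr (by linarith)
      _ < 1 / 2 := by linarith [Real.exp_neg_one_lt_half]
  refine (hp y h0 hlt).trans ((div_le_iff₀ (by linarith)).mpr ?_)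
  calc K ≤ |K| := le_abs_self K
    _ = ε * (|K| / ε) := by field_simp
    _ ≤ ε * -Real.log (dist z y) := by gcongr; linarith

/-- The condition on infima over balls and their preimages forces `p ∘ φ ≤ p` pointwise. -/
lemma comp_le_of_sInf_ball_le {X : Type*} [MetricSpace X] {φ : X → X} {p : X → ℝ} {K : ℝ}
    (hbdd : BddBelow (Set.range p))
    (hp : ∀ x y : X, 0 < dist x y → dist x y < 1 / 2 →
      |p x - p y| ≤ K / (-Real.log (dist x y)))
    (hinf : ∀ (v : X) (r : ℝ), 0 < r → (φ ⁻¹' ball v r).Nonempty →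
      sInf (p '' ball v r) ≤ sInf (p '' (φ ⁻¹' ball v r))) (x : X) :
    p (φ x) ≤ p x := by
  refine le_of_forall_pos_le_add fun ε hε => ?_
  obtain ⟨r, hr, h⟩ := exists_ball_abs_sub_le_of_logHolder (hp (φ x)) hε
  have hx : x ∈ φ ⁻¹' ball (φ x) r := mem_ball_self hr
  have hlower : p (φ x) - ε ≤ sInf (p '' ball (φ x) r) := by
    refine le_csInf ((nonempty_ball.mpr hr).image p) ?_
    rintro _ ⟨y, hy, rfl⟩
    linarith [le_abs_self (p (φ x) - p y), h y hy]
  have hupper : sInf (p '' (φ ⁻¹' ball (φ x) r)) ≤ p x :=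
    csInf_le (hbdd.mono (Set.image_subset_range _ _)) ⟨x, hx, rfl⟩
  linarith [hinf (φ x) r hr ⟨x, hx⟩]

/-- Let `μ` be Ahlfors `Q`-regular on a separable metric space, `φ` a non-singular Borel map and
`p` locally log-Hölder continuous with `inf_{φ⁻¹(B)} p ≥ inf_B p` for every open ball `B`.
Then there is `C₀ > 0` such that for every measurable `A` with `μ(A) > 0` and every open
ball `B` meeting `A` with `μ(B) < 1`, one has `μ(B)^(1 − p(x)/p(φ(x))) ≥ C₀` for every
`x ∈ φ⁻¹(A ∩ B)`. -/
theorem statement7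
    {X : Type*} [MetricSpace X] [TopologicalSpace.SeparableSpace X]
    [MeasurableSpace X] [BorelSpace X]
    (μ : Measure X) (Q c C : ℝ) (hQ : 0 < Q) (hc : 0 < c) (hC : 0 < C)
    (hAhlfors : ∀ (x : X) (r : ℝ), 0 < r →
      ENNReal.ofReal r ≤ EMetric.diam (Set.univ : Set X) →
      ENNReal.ofReal (c * r ^ Q) ≤ μ (ball x r) ∧ μ (ball x r) ≤ ENNReal.ofReal (C * r ^ Q))
    (φ : X → X) (hφ : Measurable φ)
    (hns : ∀ E : Set X, MeasurableSet E → μ E = 0 → μ (φ ⁻¹' E) = 0)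
    (p : X → ℝ) (hp1 : ∀ x, 1 ≤ p x)
    (K₀ : ℝ)
    (hLH0 : ∀ x y : X, 0 < dist x y → dist x y < 1 / 2 →
      |p x - p y| ≤ K₀ / (-Real.log (dist x y)))
    (hinf : ∀ (v : X) (r : ℝ), 0 < r → (φ ⁻¹' ball v r).Nonempty →
      sInf (p '' ball v r) ≤ sInf (p '' (φ ⁻¹' ball v r))) :
    ∃ C₀ : ℝ, 0 < C₀ ∧
      ∀ A : Set X, MeasurableSet A → 0 < μ A →
      ∀ (v : X) (r : ℝ), 0 < r → (A ∩ ball v r).Nonempty → μ (ball v r) < 1 →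
      ∀ x ∈ φ ⁻¹' (A ∩ ball v r),
        ENNReal.ofReal C₀ ≤ μ (ball v r) ^ (1 - p x / p (φ x)) := by
  refine ⟨1, one_pos, fun A _ _ v r _ _ hlt x _ => ?_⟩
  have hle : p (φ x) ≤ p x :=
    comp_le_of_sInf_ball_le ⟨1, by rintro _ ⟨y, rfl⟩; exact hp1 y⟩ hLH0 hinf x
  have hexp : 1 - p x / p (φ x) ≤ 0 :=
    sub_nonpos.mpr ((one_le_div (by linarith [hp1 (φ x)])).mpr hle)
  rw [ENNReal.ofReal_one]
  simpa using ENNReal.rpow_le_rpow_of_exponent_ge hlt.le hexp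
end

section
/- Let (X, μ) be a measure space with μ σ-finite, p : X → [1,∞) measurable, and φ : X → X a measurable non-singular map whose pushforward measure E ↦ μ(φ⁻¹(E)) is σ-finite, with Radon–Nikodym derivative u_φ. Then for every measurable f : X → ℝ and every η > 0 one has the modular identity ∫_X |f(φ(x))/η|^{p(φ(x))} dμ(x) = ∫_X |u_φ(x)^{1/p(x)} f(x)/η|^{p(x)} dμ(x); consequently the Luxemburg norms coincide: ‖f∘φ‖_{(p∘φ)(·)} = ‖u_φ^{1/p(·)}·f‖_{p(·)}. -/
open MeasureTheory Metric Filter ENNReal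

/-- The Luxemburg norm of an `ℝ≥0∞`-valued function with respect to a variable exponent `q`
(with the convention `inf ∅ = ∞`). -/
noncomputable def luxNormE {X : Type*} [MeasurableSpace X]
    (μ : Measure X) (q : X → ℝ) (g : X → ℝ≥0∞) : ℝ≥0∞ :=
  sInf {η : ℝ≥0∞ | ∫⁻ x, (g x / η) ^ q x ∂μ ≤ 1}

theorem map_eq_withDensity_of_measure_preimage {X : Type*} [MeasurableSpace X]
    {μ : Measure X} {φ : X → X} (hφ : Measurable φ) {u : X → ℝ≥0∞}
    (hu : ∀ E : Set X, MeasurableSet E → μ (φ ⁻¹' E) = ∫⁻ x in E, u x ∂μ) :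
    μ.map φ = μ.withDensity u := by
  ext E hE
  rw [Measure.map_apply hφ hE, withDensity_apply _ hE, hu E hE]

/-- Change of variables for the modular of a variable exponent. -/
theorem lintegral_rpow_comp_eq {X : Type*} [MeasurableSpace X]
    {μ : Measure X} {p : X → ℝ} (hp_meas : Measurable p) (hp : ∀ x, 0 < p x)
    {φ : X → X} (hφ : Measurable φ) {u : X → ℝ≥0∞} (hu_meas : Measurable u)
    (hmap : μ.map φ = μ.withDensity u) {g : X → ℝ≥0∞} (hg : Measurable g) :
    ∫⁻ x, g (φ x) ^ p (φ x) ∂μ = ∫⁻ x, (u x ^ (1 / p x) * g x) ^ p x ∂μ := by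
  have hgp : Measurable fun x => g x ^ p x := hg.pow hp_meas
  rw [← lintegral_map hgp hφ, hmap, lintegral_withDensity_eq_lintegral_mul _ hu_meas hgp]
  refine lintegral_congr fun x => ?_
  rw [ENNReal.mul_rpow_of_nonneg _ _ (hp x).le, ← ENNReal.rpow_mul,
    one_div_mul_cancel (hp x).ne', ENNReal.rpow_one, Pi.mul_apply]

/-- Let `(X,μ)` be a σ-finite measure space, `p : X → [1,∞)` measurable, and `φ` a measurable
non-singular map with σ-finite pushforward and Radon–Nikodym derivative `u`. Then for every
measurable `f` and every `η > 0` the modular identity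
`∫ |f(φ x)/η|^{p(φ x)} dμ = ∫ |u(x)^{1/p(x)} f(x)/η|^{p(x)} dμ` holds; consequently the
Luxemburg norms coincide: `‖f∘φ‖_{(p∘φ)(·)} = ‖u^{1/p(·)}·f‖_{p(·)}`. -/
theorem statement12
    {X : Type*} [MeasurableSpace X]
    (μ : Measure X) [SigmaFinite μ]
    (p : X → ℝ) (hp_meas : Measurable p) (hp1 : ∀ x, 1 ≤ p x)
    (φ : X → X) (hφ : Measurable φ)
    (hns : ∀ E : Set X, MeasurableSet E → μ E = 0 → μ (φ ⁻¹' E) = 0)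
    [SigmaFinite (μ.map φ)]
    (u : X → ℝ≥0∞) (hu_meas : Measurable u)
    (hu : ∀ E : Set X, MeasurableSet E → μ (φ ⁻¹' E) = ∫⁻ x in E, u x ∂μ) :
    ∀ f : X → ℝ, Measurable f →
      (∀ η : ℝ, 0 < η →
        ∫⁻ x, ENNReal.ofReal (|f (φ x)| / η) ^ p (φ x) ∂μ =
          ∫⁻ x, (u x ^ (1 / p x) * ENNReal.ofReal (|f x| / η)) ^ p x ∂μ) ∧
      luxNormE μ (fun x => p (φ x)) (fun x => ENNReal.ofReal |f (φ x)|) =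
        luxNormE μ p (fun x => u x ^ (1 / p x) * ENNReal.ofReal |f x|) := by
  intro f hf
  have hmap := map_eq_withDensity_of_measure_preimage hφ hu
  have hp : ∀ x, 0 < p x := fun x => one_pos.trans_le (hp1 x)
  have habs : Measurable fun x => |f x| := hf.abs
  refine ⟨fun η _ => lintegral_rpow_comp_eq hp_meas hp hφ hu_meas hmap
    (habs.div_const η).ennreal_ofReal, ?_⟩
  unfold luxNormE
  congr! 4 with η
  simp_rw [mul_div_assoc]
  exact lintegral_rpow_comp_eq hp_meas hp hφ hu_meas hmap (habs.ennreal_ofReal.div_const η)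
end

section
/- Let (X,d) be a connected metric space with at least two points and μ a nonzero doubling Borel measure on X that is positive on nonempty open sets and finite on bounded sets. Then μ has no atoms: for every Borel set E with μ(E) > 0 there exists a Borel subset F ⊆ E with 0 < μ(F) < μ(E). -/
open MeasureTheory Metric Filter ENNReal
open Topology

theorem sigmaFinite_of_measure_ball_lt_top {X : Type*} [PseudoMetricSpace X] [MeasurableSpace X]
    {μ : Measure X} (hfin : ∀ (x : X) (r : ℝ), μ (ball x r) < ∞) : SigmaFinite μ := by
  rcases isEmpty_or_nonempty X with _ | ⟨⟨x⟩⟩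
  · rw [Measure.eq_zero_of_isEmpty μ]
    infer_instance
  · exact ⟨⟨⟨fun n : ℕ => ball x n, fun _ => trivial, fun n => hfin x n, iUnion_ball_nat x⟩⟩⟩

/-- A metric space carrying an s-finite measure that is positive on nonempty open sets is second
countable. -/
theorem secondCountableTopology_of_isOpenPosMeasure {X : Type*} [PseudoMetricSpace X]
    [MeasurableSpace X] [OpensMeasurableSpace X] (μ : Measure X) [SFinite μ]
    [μ.IsOpenPosMeasure] : SecondCountableTopology X := by
  refine Metric.secondCountable_of_almost_dense_set fun ε hε => ?_
  obtain ⟨u, -, hdisj, hcov⟩ := Vitali.exists_disjoint_subfamily_covering_enlargement_ball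
    (Set.univ : Set X) id (fun _ => ε / 4) (ε / 4) (fun _ _ => le_rfl) 4 (by norm_num)
  refine ⟨u, ?_, fun x => ?_⟩
  · have hcount := Measure.countable_meas_pos_of_disjoint_iUnion (μ := μ)
      (As := fun y : u => ball (y : X) (ε / 4)) (fun _ => measurableSet_ball)
      (fun y z hyz => hdisj y.2 z.2 (Subtype.coe_injective.ne hyz))
    have huniv : {y : u | 0 < μ (ball (y : X) (ε / 4))} = Set.univ :=
      Set.eq_univ_of_forall fun y => measure_ball_pos μ _ (by positivity)
    rw [huniv] at hcount
    exact Set.countable_coe_iff.1 (Set.countable_univ_iff.1 hcount)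
  · obtain ⟨y, hy, hxy⟩ := hcov x (Set.mem_univ x)
    have hx : dist x y < 4 * (ε / 4) := hxy (mem_ball_self (by positivity))
    exact ⟨y, hy, by linarith⟩

theorem tendsto_measure_ball_zero {X : Type*} [MetricSpace X] [MeasurableSpace X]
    [OpensMeasurableSpace X] {μ : Measure X} (hfin : ∀ (x : X) (r : ℝ), μ (ball x r) < ∞) (z : X) :
    Tendsto (fun r => μ (ball z r)) (𝓝[>] 0) (𝓝 (μ {z})) := by
  have hinter : ⋂ r > (0 : ℝ), ball z r = {z} := by
    ext w
    simp only [Set.mem_iInter, mem_ball, Set.mem_singleton_iff]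
    refine ⟨fun h => dist_le_zero.1 (le_of_forall_pos_le_add fun ε hε => ?_), ?_⟩
    · simpa using (h ε hε).le
    · rintro rfl r hr
      simpa using hr
  rw [← hinter]
  exact tendsto_measure_biInter_gt (fun _ _ => measurableSet_ball.nullMeasurableSet)
    (fun _ _ _ hij => ball_subset_ball hij) ⟨1, one_pos, (hfin z 1).ne⟩

/-- A doubling measure that is finite on balls does not charge any non-isolated point. -/
theorem measure_singleton_eq_zero_of_doubling {X : Type*} [MetricSpace X] [MeasurableSpace X]
    [OpensMeasurableSpace X] {μ : Measure X} (hfin : ∀ (x : X) (r : ℝ), μ (ball x r) < ∞)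
    (C : NNReal) (hdb : ∀ (x : X) (r : ℝ), 0 < r → μ (ball x (2 * r)) ≤ C * μ (ball x r))
    (z : X) [(𝓝[≠] z).NeBot] : μ {z} = 0 := by
  have hz : μ {z} ≠ ∞ :=
    ((measure_mono (Set.singleton_subset_iff.2 (mem_ball_self one_pos))).trans_lt (hfin z 1)).ne
  have hdist : Tendsto (fun w => 2 * dist w z) (𝓝[≠] z) (𝓝[>] 0) := by
    refine tendsto_nhdsWithin_iff.2 ⟨?_, ?_⟩
    · have hcont : Continuous fun w => 2 * dist w z := by fun_prop
      simpa using (hcont.tendsto z).mono_left nhdsWithin_le_nhds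
    · filter_upwards [self_mem_nhdsWithin] with w hw
      have : 0 < dist w z := dist_pos.2 hw
      exact Set.mem_Ioi.2 (by positivity)
  have hlim : Tendsto (fun w => C * (μ (ball z (2 * dist w z)) - μ {z})) (𝓝[≠] z) (𝓝 0) := by
    have h := ENNReal.Tendsto.const_mul (a := (C : ℝ≥0∞))
      (ENNReal.Tendsto.sub ((tendsto_measure_ball_zero hfin z).comp hdist)
        (tendsto_const_nhds (x := μ {z})) (Or.inl hz)) (Or.inr ENNReal.coe_ne_top)
    simpa using h
  refine le_antisymm (ge_of_tendsto hlim ?_) zero_le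
  filter_upwards [self_mem_nhdsWithin] with w hw
  have hpos : 0 < dist w z := dist_pos.2 hw
  have hzw : {z} ⊆ ball w (2 * dist w z) := by
    rw [Set.singleton_subset_iff, mem_ball, dist_comm]
    linarith
  have hsub : ball w (dist w z) ⊆ ball z (2 * dist w z) \ {z} := by
    refine fun y hy => ⟨?_, ?_⟩
    · exact ball_subset_ball' (by linarith) hy
    · rintro rfl
      exact lt_irrefl _ ((dist_comm w y).trans_lt hy)
  calc μ {z} ≤ μ (ball w (2 * dist w z)) := measure_mono hzw
    _ ≤ C * μ (ball w (dist w z)) := hdb w _ hpos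
    _ ≤ C * μ (ball z (2 * dist w z) \ {z}) := by gcongr
    _ = C * (μ (ball z (2 * dist w z)) - μ {z}) := by
      rw [measure_sdiff (Set.singleton_subset_iff.2 (mem_ball_self (by positivity)))
        (measurableSet_singleton z).nullMeasurableSet hz]

/-- Every connected metric space with at least two points, equipped with a nonzero doubling
Borel measure that is positive on nonempty open sets and finite on bounded sets, carries no
atoms: every Borel set of positive measure contains a Borel subset of strictly intermediate
positive measure. -/
theorem statement13
    {X : Type*} [MetricSpace X] [ConnectedSpace X] [Nontrivial X]
    [MeasurableSpace X] [BorelSpace X]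
    (μ : Measure X) (hμ : μ ≠ 0) [μ.IsOpenPosMeasure]
    (hfin : ∀ s : Set X, Bornology.IsBounded s → μ s < ∞)
    (C_d : NNReal) (hdb : ∀ (x : X) (r : ℝ), 0 < r → μ (ball x (2 * r)) ≤ C_d * μ (ball x r)) :
    ∀ E : Set X, MeasurableSet E → 0 < μ E →
      ∃ F : Set X, MeasurableSet F ∧ F ⊆ E ∧ 0 < μ F ∧ μ F < μ E := by
  intro E hE hEpos
  have hball : ∀ (x : X) (r : ℝ), μ (ball x r) < ∞ := fun _ _ => hfin _ isBounded_ball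
  have := sigmaFinite_of_measure_ball_lt_top hball
  have := secondCountableTopology_of_isOpenPosMeasure μ
  obtain ⟨z, -, hz⟩ := exists_mem_forall_mem_nhdsWithin_pos_measure hEpos.ne'
  have hlim := tendsto_measure_ball_zero hball z
  rw [measure_singleton_eq_zero_of_doubling hball C_d hdb z] at hlim
  obtain ⟨r, hr, hrpos⟩ := ((hlim.eventually_lt_const hEpos).and self_mem_nhdsWithin).exists
  refine ⟨E ∩ ball z r, hE.inter measurableSet_ball, Set.inter_subset_left,
    hz _ (Filter.inter_mem self_mem_nhdsWithin (mem_nhdsWithin_of_mem_nhds (ball_mem_nhds z hrpos))),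
    (measure_mono Set.inter_subset_right).trans_lt hr⟩
end

section
/- Let λ be Lebesgue measure on [0,1] and r : [0,1] → [1,∞) measurable with ess sup r < ∞, λ(r⁻¹({1})) = 0, and ess inf r = 1 (that is, λ({z : r(z) < 1 + δ}) > 0 for every δ > 0). Let u : [0,1] → [0,∞) be measurable with u(z) ≥ M for a.e. z, where M > 0. Then for every t ∈ (0,1) there exist 0 ≤ a < b ≤ 1 such that the function f_{ab}(z) := (b−a)^{−1/r(z)}·χ_{[a,b]}(z) satisfies ∫₀¹ f_{ab}(z)^{r(z)} dz ≤ 1 and t^{−1} ∫₀¹ t^{r(z)} f_{ab}(z)^{r(z)} u(z) dz ≥ M/2. (Applied with u = u_φ, this shows the image of the unit ball of L^{r(·)}([0,1]) under T_φ fails the equi-integrability criterion characterizing relatively weakly compact subsets of variable Lebesgue spaces, so T_φ is not weakly compact when ess inf u_φ > 0.) -/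
open MeasureTheory Metric Filter ENNReal

/-- A set of positive measure inside `(0, 1)` fills at least the proportion `c < 1` of some
nondegenerate interval `[a, b] ⊆ [0, 1]`. -/
theorem exists_Icc_ofReal_mul_le_volume_inter {A : Set ℝ}
    (hA : volume (A ∩ Set.Ioo (0:ℝ) 1) ≠ 0) {c : ℝ} (hc0 : 0 ≤ c) (hc : c < 1) :
    ∃ a b : ℝ, 0 ≤ a ∧ a < b ∧ b ≤ 1 ∧
      ENNReal.ofReal (c * (b - a)) ≤ volume (A ∩ Set.Icc a b) := by
  have hdens := Besicovitch.ae_tendsto_measure_inter_div (volume : Measure ℝ)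
    (A ∩ Set.Ioo (0:ℝ) 1)
  have : NeBot (ae (volume.restrict (A ∩ Set.Ioo (0:ℝ) 1))) := by
    rwa [ae_neBot, Ne, Measure.restrict_eq_zero]
  have hmem : ∃ᵐ x ∂(volume.restrict (A ∩ Set.Ioo (0:ℝ) 1)), x ∈ Set.Ioo (0:ℝ) 1 := by
    refine Eventually.frequently ?_
    exact ae_mono (Measure.restrict_mono_set volume Set.inter_subset_right)
      (ae_restrict_mem measurableSet_Ioo)
  obtain ⟨x, ⟨hx0, hx1⟩, hx⟩ := (hmem.and_eventually hdens).exists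
  have hlt : ENNReal.ofReal c < 1 := by simpa using hc
  have hsmall : ∀ᶠ ρ : ℝ in nhdsWithin 0 (Set.Ioi 0), ρ ∈ Set.Ioo 0 (min x (1 - x)) :=
    Ioo_mem_nhdsGT (by simp [hx0, hx1])
  obtain ⟨ρ, hρ, hρ0, hρx⟩ := ((hx.eventually_const_lt hlt).and hsmall).exists
  obtain ⟨hρ1, hρ2⟩ := lt_min_iff.1 hρx
  refine ⟨x - ρ, x + ρ, by linarith, by linarith, by linarith, ?_⟩
  rw [Real.closedBall_eq_Icc] at hρ
  calc ENNReal.ofReal (c * (x + ρ - (x - ρ)))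
      = ENNReal.ofReal c * volume (Set.Icc (x - ρ) (x + ρ)) := by
        rw [Real.volume_Icc, ENNReal.ofReal_mul hc0]
    _ ≤ volume (A ∩ Set.Ioo (0:ℝ) 1 ∩ Set.Icc (x - ρ) (x + ρ)) :=
        ENNReal.mul_le_of_le_div hρ.le
    _ ≤ volume (A ∩ Set.Icc (x - ρ) (x + ρ)) :=
        measure_mono (Set.inter_subset_inter_left _ Set.inter_subset_left)

/-- The `r(z)`-th power of `L^{-1/r(z)} χ_s(z)` is `L⁻¹ χ_s(z)`. -/
theorem ofReal_indicator_rpow_neg_inv_rpow {r : ℝ → ℝ} {L : ℝ} (hL : 0 < L) (s : Set ℝ)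
    {z : ℝ} (hr : 0 < r z) :
    ENNReal.ofReal (s.indicator (fun w => L ^ (-(1 / r w))) z) ^ r z =
      s.indicator (fun _ => ENNReal.ofReal L⁻¹) z := by
  by_cases hz : z ∈ s
  · rw [Set.indicator_of_mem hz, Set.indicator_of_mem hz,
      ENNReal.ofReal_rpow_of_pos (Real.rpow_pos_of_pos hL _), ← Real.rpow_mul hL.le,
      neg_mul, one_div_mul_cancel hr.ne', Real.rpow_neg_one]
  · simp [Set.indicator_of_notMem hz, hr]

/-- Let `r : [0,1] → [1,∞)` be measurable with finite essential supremum, with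
`λ(r⁻¹({1})) = 0` and essential infimum `1` (every level set `{r < 1 + δ}` has positive
measure), and let `u ≥ M > 0` a.e. on `[0,1]`. Then for every `t ∈ (0,1)` there is an
interval `[a,b] ⊆ [0,1]` such that `f_{ab}(z) = (b−a)^{−1/r(z)}·χ_{[a,b]}(z)` has modular
at most `1` while `t⁻¹ ∫ t^{r(z)} f_{ab}(z)^{r(z)} u(z) dz ≥ M/2`. -/
theorem statement14
    (r : ℝ → ℝ) (hr_meas : Measurable r) (hr1 : ∀ z, 1 ≤ r z)
    (R : ℝ) (hR : ∀ᵐ z ∂(volume.restrict (Set.Icc (0:ℝ) 1)), r z ≤ R)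
    (hΩ₁ : volume ({z | r z = 1} ∩ Set.Icc (0:ℝ) 1) = 0)
    (hinf : ∀ δ : ℝ, 0 < δ → 0 < volume ({z | r z < 1 + δ} ∩ Set.Icc (0:ℝ) 1))
    (u : ℝ → ℝ) (hu_meas : Measurable u) (hu0 : ∀ z, 0 ≤ u z)
    (M : ℝ) (hM : 0 < M)
    (huM : ∀ᵐ z ∂(volume.restrict (Set.Icc (0:ℝ) 1)), M ≤ u z) :
    ∀ t : ℝ, 0 < t → t < 1 →
      ∃ a b : ℝ, 0 ≤ a ∧ a < b ∧ b ≤ 1 ∧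
        (∫⁻ z in Set.Icc (0:ℝ) 1,
            ENNReal.ofReal
              (Set.indicator (Set.Icc a b) (fun w => (b - a) ^ (-(1 / r w))) z) ^ r z
            ∂volume) ≤ 1 ∧
        ENNReal.ofReal (M / 2) ≤
          ENNReal.ofReal t⁻¹ *
            ∫⁻ z in Set.Icc (0:ℝ) 1,
              ENNReal.ofReal t ^ r z *
                ENNReal.ofReal
                  (Set.indicator (Set.Icc a b) (fun w => (b - a) ^ (-(1 / r w))) z) ^ r z *
                ENNReal.ofReal (u z) ∂volume := by
  intro t ht0 ht1
  have hδ : 0 < Real.logb t (3 / 4) :=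
    Real.logb_pos_of_base_lt_one ht0 ht1 (by norm_num) (by norm_num)
  set δ := Real.logb t (3 / 4)
  have htδ : t ^ (1 + δ) = t * (3 / 4) := by
    rw [Real.rpow_add ht0, Real.rpow_one, Real.rpow_logb ht0 ht1.ne (by norm_num)]
  have hAmeas : MeasurableSet {z | r z < 1 + δ} := measurableSet_lt hr_meas measurable_const
  obtain ⟨a, b, ha, hab, hb, hvol⟩ := exists_Icc_ofReal_mul_le_volume_inter
    (A := {z | r z < 1 + δ}) (c := 3 / 4)
    (by
      rw [measure_congr ((ae_eq_refl _).inter Ioo_ae_eq_Icc)]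
      exact (hinf δ hδ).ne')
    (by norm_num) (by norm_num)
  have hL : 0 < b - a := sub_pos.2 hab
  have hsub : Set.Icc a b ⊆ Set.Icc (0:ℝ) 1 := Set.Icc_subset_Icc ha hb
  have hpow := fun z =>
    ofReal_indicator_rpow_neg_inv_rpow hL (Set.Icc a b) (zero_lt_one.trans_le (hr1 z))
  refine ⟨a, b, ha, hab, hb, ?_⟩
  simp only [hpow]
  constructor
  · calc ∫⁻ z in Set.Icc (0:ℝ) 1, (Set.Icc a b).indicator (fun _ => ENNReal.ofReal (b - a)⁻¹) z
        ≤ ∫⁻ z, (Set.Icc a b).indicator (fun _ => ENNReal.ofReal (b - a)⁻¹) z :=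
          setLIntegral_le_lintegral _ _
      _ = 1 := by
          rw [lintegral_indicator_const measurableSet_Icc, Real.volume_Icc,
            ← ENNReal.ofReal_mul (inv_nonneg.2 hL.le), inv_mul_cancel₀ hL.ne',
            ENNReal.ofReal_one]
  · set S := {z | r z < 1 + δ} ∩ Set.Icc a b
    have hSsub : S ⊆ Set.Icc (0:ℝ) 1 := Set.inter_subset_right.trans hsub
    have hlower : ENNReal.ofReal (t * (3 / 4) * (b - a)⁻¹ * M) * volume S ≤
        ∫⁻ z in Set.Icc (0:ℝ) 1, ENNReal.ofReal t ^ r z *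
          (Set.Icc a b).indicator (fun _ => ENNReal.ofReal (b - a)⁻¹) z *
            ENNReal.ofReal (u z) := by
      rw [← setLIntegral_const]
      refine le_trans (lintegral_mono_ae ?_) (lintegral_mono_set hSsub)
      filter_upwards [ae_restrict_mem (hAmeas.inter measurableSet_Icc),
        ae_mono (Measure.restrict_mono_set volume hSsub) huM] with z hz hMz
      rw [Set.indicator_of_mem hz.2, ENNReal.ofReal_mul (by positivity),
        ENNReal.ofReal_mul (by positivity), ENNReal.ofReal_rpow_of_pos ht0, ← htδ]
      have hpow_le := Real.rpow_le_rpow_of_exponent_ge ht0 ht1.le (le_of_lt hz.1)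
      exact mul_le_mul' (mul_le_mul_left (ENNReal.ofReal_le_ofReal hpow_le) _)
        (ENNReal.ofReal_le_ofReal hMz)
    calc ENNReal.ofReal (M / 2)
        ≤ ENNReal.ofReal (t⁻¹ * (t * (3 / 4) * (b - a)⁻¹ * M * (3 / 4 * (b - a)))) := by
          apply ENNReal.ofReal_le_ofReal
          have : t⁻¹ * (t * (3 / 4) * (b - a)⁻¹ * M * (3 / 4 * (b - a))) = 9 / 16 * M := by
            field_simp
            norm_num
          linarith
      _ = ENNReal.ofReal t⁻¹ * (ENNReal.ofReal (t * (3 / 4) * (b - a)⁻¹ * M) *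
            ENNReal.ofReal (3 / 4 * (b - a))) := by
          rw [ENNReal.ofReal_mul (by positivity), ENNReal.ofReal_mul (by positivity)]
      _ ≤ _ := by
          gcongr
          exact le_trans (by gcongr) hlower
end

section
/- Let λ be Lebesgue measure on [0,1], r : [0,1] → [1,∞) measurable, Ω₁ := r⁻¹({1}) with λ(Ω₁) > 0, and let z₀ ∈ (0,1) be a Lebesgue density point of Ω₁. Let φ : [0,1] → [0,1] be a non-singular measurable map with Radon–Nikodym derivative u_φ satisfying u_φ(z) ≥ M for a.e. z, where M > 0. For n ∈ ℕ set I_n := (z₀ − 2^{−n}, z₀ + 2^{−n}) ∩ [0,1] and f_n := λ(I_n)^{−1}·χ_{I_n ∩ Ω₁}. Then: (a) ∫₀¹ f_n(z)^{r(z)} dz ≤ 1 for every n; (b) λ(φ⁻¹(I_n)) → 0 as n → ∞; and (c) liminf_{n→∞} ∫_{φ⁻¹(I_n)} f_n(φ(x)) dx ≥ M. In particular the sequence {f_n∘φ} is bounded in modular but not equi-integrable. -/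
open MeasureTheory Metric Filter ENNReal

/-- The interval `I_n = (z₀ − 2^{−n}, z₀ + 2^{−n}) ∩ [0,1]`. -/
def In (z₀ : ℝ) (n : ℕ) : Set ℝ :=
  Set.Ioo (z₀ - 2 ^ (-(n : ℝ))) (z₀ + 2 ^ (-(n : ℝ))) ∩ Set.Icc 0 1

/-- The function `f_n = λ(I_n)⁻¹ · χ_{I_n ∩ Ω₁}`, where `Ω₁ = {z ∈ [0,1] : r z = 1}`. -/
noncomputable def fn (r : ℝ → ℝ) (z₀ : ℝ) (n : ℕ) : ℝ → ℝ :=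
  Set.indicator (In z₀ n ∩ {z | r z = 1})
    (fun _ => ((volume (In z₀ n)).toReal)⁻¹)

theorem measurableSet_In (z₀ : ℝ) (n : ℕ) : MeasurableSet (In z₀ n) :=
  measurableSet_Ioo.inter measurableSet_Icc

theorem In_subset_Icc (z₀ : ℝ) (n : ℕ) : In z₀ n ⊆ Set.Icc 0 1 :=
  Set.inter_subset_right

theorem tendsto_two_rpow_neg_natCast :
    Tendsto (fun n : ℕ => (2 : ℝ) ^ (-(n : ℝ))) atTop (nhdsWithin 0 (Set.Ioi 0)) := by
  refine tendsto_nhdsWithin_iff.2 ⟨?_, Eventually.of_forall fun n => by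
    simp only [Set.mem_Ioi]; positivity⟩
  have h := tendsto_pow_atTop_nhds_zero_of_lt_one (r := (2⁻¹ : ℝ)) (by norm_num) (by norm_num)
  refine h.congr fun n => ?_
  rw [Real.rpow_neg (by norm_num), Real.rpow_natCast, inv_pow]

theorem antitone_In (z₀ : ℝ) : Antitone (In z₀) := by
  intro m n hmn
  have h : (2 : ℝ) ^ (-(n : ℝ)) ≤ 2 ^ (-(m : ℝ)) :=
    Real.rpow_le_rpow_of_exponent_le (by norm_num) (neg_le_neg (Nat.cast_le.2 hmn))
  exact Set.inter_subset_inter_left _ (Set.Ioo_subset_Ioo (by linarith) (by linarith))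

theorem iInter_In_subset (z₀ : ℝ) : ⋂ n, In z₀ n ⊆ {z₀} := by
  intro z hz
  have hlt : ∀ n : ℕ, |z - z₀| ≤ 2 ^ (-(n : ℝ)) := fun n => by
    have h := (Set.mem_iInter.1 hz n).1
    exact abs_le.2 ⟨by linarith [h.1], by linarith [h.2]⟩
  have h0 := ge_of_tendsto' (tendsto_nhdsWithin_iff.1 tendsto_two_rpow_neg_natCast).1 hlt
  exact sub_eq_zero.1 (abs_nonpos_iff.1 h0)

theorem volume_In_ne_zero {z₀ : ℝ} (hz₀ : z₀ ∈ Set.Ioo (0 : ℝ) 1) (n : ℕ) :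
    volume (In z₀ n) ≠ 0 := by
  have hpos : (0 : ℝ) < 2 ^ (-(n : ℝ)) := by positivity
  exact (Measure.measure_pos_of_mem_nhds volume (inter_mem
    (Ioo_mem_nhds (by linarith) (by linarith)) (Icc_mem_nhds hz₀.1 hz₀.2))).ne'

theorem volume_In_ne_top (z₀ : ℝ) (n : ℕ) : volume (In z₀ n) ≠ ∞ :=
  measure_ne_top_of_subset (In_subset_Icc z₀ n) measure_Icc_lt_top.ne

theorem ofReal_fn (r : ℝ → ℝ) {z₀ : ℝ} (hz₀ : z₀ ∈ Set.Ioo (0 : ℝ) 1) (n : ℕ) (z : ℝ) :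
    ENNReal.ofReal (fn r z₀ n z) =
      Set.indicator (In z₀ n ∩ {z | r z = 1}) (fun _ => (volume (In z₀ n))⁻¹) z := by
  by_cases hz : z ∈ In z₀ n ∩ {z | r z = 1}
  · rw [fn, Set.indicator_of_mem hz, Set.indicator_of_mem hz, ENNReal.ofReal_inv_of_pos
      (ENNReal.toReal_pos (volume_In_ne_zero hz₀ n) (volume_In_ne_top z₀ n)),
      ENNReal.ofReal_toReal (volume_In_ne_top z₀ n)]
  · rw [fn, Set.indicator_of_notMem hz, Set.indicator_of_notMem hz, ENNReal.ofReal_zero]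

/-- Each `f_n` has modular at most `1`. -/
theorem lintegral_ofReal_fn_rpow_le_one {r : ℝ → ℝ} (hr_meas : Measurable r)
    (hr1 : ∀ z, 1 ≤ r z) {z₀ : ℝ} (hz₀ : z₀ ∈ Set.Ioo (0 : ℝ) 1) (n : ℕ) :
    ∫⁻ z in Set.Icc (0 : ℝ) 1, ENNReal.ofReal (fn r z₀ n z) ^ r z ≤ 1 := by
  have hmeas : MeasurableSet (In z₀ n ∩ {z | r z = 1}) :=
    (measurableSet_In z₀ n).inter (hr_meas (measurableSet_singleton 1))
  have hrpow : ∀ z, ENNReal.ofReal (fn r z₀ n z) ^ r z =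
      Set.indicator (In z₀ n ∩ {z | r z = 1}) (fun _ => (volume (In z₀ n))⁻¹) z := by
    intro z
    rw [ofReal_fn r hz₀]
    by_cases hz : z ∈ In z₀ n ∩ {z | r z = 1}
    · rw [Set.indicator_of_mem hz, show r z = 1 from hz.2, ENNReal.rpow_one]
    · rw [Set.indicator_of_notMem hz, ENNReal.zero_rpow_of_pos (zero_lt_one.trans_le (hr1 z))]
  calc ∫⁻ z in Set.Icc (0 : ℝ) 1, ENNReal.ofReal (fn r z₀ n z) ^ r z
      = (volume (In z₀ n))⁻¹ * volume.restrict (Set.Icc 0 1) (In z₀ n ∩ {z | r z = 1}) := by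
        simp_rw [hrpow]
        rw [lintegral_indicator_const hmeas]
    _ ≤ (volume (In z₀ n))⁻¹ * volume (In z₀ n) := by
        gcongr
        exacts [Measure.restrict_le_self, Set.inter_subset_left]
    _ ≤ 1 := ENNReal.inv_mul_le_one _

theorem tendsto_measure_preimage_In {μ : Measure ℝ} [IsFiniteMeasure μ] {φ : ℝ → ℝ}
    (hφ : Measurable φ) {z₀ : ℝ} (h0 : μ (φ ⁻¹' {z₀}) = 0) :
    Tendsto (fun n : ℕ => μ (φ ⁻¹' In z₀ n)) atTop (nhds 0) := by
  have h := tendsto_measure_iInter_atTop (μ := μ) (s := fun n => φ ⁻¹' In z₀ n)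
    (fun n => (hφ (measurableSet_In z₀ n)).nullMeasurableSet)
    (fun _ _ hmn => Set.preimage_mono (antitone_In z₀ hmn)) ⟨0, measure_ne_top _ _⟩
  rwa [← Set.preimage_iInter,
    measure_mono_null (Set.preimage_mono (iInter_In_subset z₀)) h0] at h

theorem setLIntegral_ofReal_fn_comp (μ : Measure ℝ) {r φ : ℝ → ℝ} (hr_meas : Measurable r)
    (hφ : Measurable φ) {z₀ : ℝ} (hz₀ : z₀ ∈ Set.Ioo (0 : ℝ) 1) (n : ℕ) :
    ∫⁻ x in φ ⁻¹' In z₀ n, ENNReal.ofReal (fn r z₀ n (φ x)) ∂μ =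
      (volume (In z₀ n))⁻¹ * μ (φ ⁻¹' (In z₀ n ∩ {z | r z = 1})) := by
  have hmeas : MeasurableSet (φ ⁻¹' (In z₀ n ∩ {z | r z = 1})) :=
    hφ ((measurableSet_In z₀ n).inter (hr_meas (measurableSet_singleton 1)))
  have hind : ∀ x, ENNReal.ofReal (fn r z₀ n (φ x)) =
      Set.indicator (φ ⁻¹' (In z₀ n ∩ {z | r z = 1})) (fun _ => (volume (In z₀ n))⁻¹) x :=
    fun x => ofReal_fn r hz₀ n (φ x)
  simp_rw [hind]
  rw [lintegral_indicator_const hmeas, Measure.restrict_apply hmeas,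
    Set.inter_eq_left.2 (Set.preimage_mono Set.inter_subset_left)]

theorem mul_measure_le_setLIntegral {α : Type*} [MeasurableSpace α] {μ : Measure α}
    {c : ℝ≥0∞} {u : α → ℝ≥0∞} (h : ∀ᵐ z ∂μ, c ≤ u z) (E : Set α) :
    c * μ E ≤ ∫⁻ z in E, u z ∂μ := by
  rw [← setLIntegral_const]
  exact lintegral_mono_ae (ae_restrict_of_ae h)

/-- Near an interior point of `[0,1]`, the density quotients converge along `I_n`. -/
theorem tendsto_density_In {A : Set ℝ} {z₀ : ℝ} (hz₀ : z₀ ∈ Set.Ioo (0 : ℝ) 1)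
    (hdensity : Tendsto
      (fun h : ℝ => volume (A ∩ Set.Ioo (z₀ - h) (z₀ + h)) /
        volume (Set.Ioo (z₀ - h) (z₀ + h) ∩ Set.Icc (0 : ℝ) 1))
      (nhdsWithin 0 (Set.Ioi 0)) (nhds 1)) :
    Tendsto (fun n : ℕ => volume (In z₀ n ∩ A) / volume (In z₀ n)) atTop (nhds 1) := by
  refine (hdensity.comp tendsto_two_rpow_neg_natCast).congr' ?_
  have hsmall := (tendsto_nhdsWithin_iff.1 tendsto_two_rpow_neg_natCast).1.eventually
    (Iio_mem_nhds (lt_min hz₀.1 (sub_pos.2 hz₀.2)))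
  filter_upwards [hsmall] with n hn
  obtain ⟨h1, h2⟩ := lt_min_iff.1 hn
  have hsub : Set.Ioo (z₀ - 2 ^ (-(n : ℝ))) (z₀ + 2 ^ (-(n : ℝ))) ⊆ Set.Icc 0 1 :=
    fun z hz => ⟨by linarith [hz.1], by linarith [hz.2]⟩
  simp only [Function.comp_apply, In]
  rw [Set.inter_eq_left.2 hsub, Set.inter_comm]

/-- Let `r : [0,1] → [1,∞)` be measurable, `Ω₁ = r⁻¹({1})` of positive measure, `z₀ ∈ (0,1)` a
Lebesgue density point of `Ω₁`, and `φ : [0,1] → [0,1]` a non-singular map with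
Radon–Nikodym derivative `u ≥ M > 0` a.e. With `I_n = (z₀−2^{−n}, z₀+2^{−n}) ∩ [0,1]` and
`f_n = λ(I_n)⁻¹·χ_{I_n∩Ω₁}`: (a) the modular of each `f_n` is at most `1`;
(b) `λ(φ⁻¹(I_n)) → 0`; (c) `liminf ∫_{φ⁻¹(I_n)} f_n(φ x) dx ≥ M`. -/
theorem statement15
    (r : ℝ → ℝ) (hr_meas : Measurable r) (hr1 : ∀ z, 1 ≤ r z)
    (hΩ₁ : 0 < volume ({z | r z = 1} ∩ Set.Icc (0:ℝ) 1))
    (z₀ : ℝ) (hz₀ : z₀ ∈ Set.Ioo (0:ℝ) 1)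
    (hdensity : Filter.Tendsto
      (fun h : ℝ => volume ({z | r z = 1} ∩ Set.Ioo (z₀ - h) (z₀ + h)) /
        volume (Set.Ioo (z₀ - h) (z₀ + h) ∩ Set.Icc (0:ℝ) 1))
      (nhdsWithin 0 (Set.Ioi 0)) (nhds 1))
    (φ : ℝ → ℝ) (hφ_meas : Measurable φ)
    (hφ_maps : Set.MapsTo φ (Set.Icc 0 1) (Set.Icc 0 1))
    (hns : ∀ E : Set ℝ, MeasurableSet E →
      (volume.restrict (Set.Icc (0:ℝ) 1)) E = 0 →
      (volume.restrict (Set.Icc (0:ℝ) 1)) (φ ⁻¹' E) = 0)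
    (u : ℝ → ℝ≥0∞) (hu_meas : Measurable u)
    (hu : ∀ E : Set ℝ, MeasurableSet E →
      (volume.restrict (Set.Icc (0:ℝ) 1)) (φ ⁻¹' E) =
        ∫⁻ z in E, u z ∂(volume.restrict (Set.Icc (0:ℝ) 1)))
    (M : ℝ) (hM : 0 < M)
    (huM : ∀ᵐ z ∂(volume.restrict (Set.Icc (0:ℝ) 1)), ENNReal.ofReal M ≤ u z) :
    (∀ n : ℕ, ∫⁻ z in Set.Icc (0:ℝ) 1,
        ENNReal.ofReal (fn r z₀ n z) ^ r z ∂volume ≤ 1) ∧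
    Filter.Tendsto (fun n : ℕ => (volume.restrict (Set.Icc (0:ℝ) 1)) (φ ⁻¹' In z₀ n))
      Filter.atTop (nhds 0) ∧
    ENNReal.ofReal M ≤
      Filter.atTop.liminf (fun n : ℕ =>
        ∫⁻ x in φ ⁻¹' In z₀ n, ENNReal.ofReal (fn r z₀ n (φ x))
          ∂(volume.restrict (Set.Icc (0:ℝ) 1))) := by
  refine ⟨lintegral_ofReal_fn_rpow_le_one hr_meas hr1 hz₀, tendsto_measure_preimage_In hφ_meas
    (hns {z₀} (measurableSet_singleton z₀) (measure_singleton z₀)), ?_⟩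
  have hlim := ENNReal.Tendsto.const_mul (a := ENNReal.ofReal M)
    (tendsto_density_In hz₀ hdensity) (Or.inr ENNReal.ofReal_ne_top)
  rw [mul_one] at hlim
  rw [← hlim.liminf_eq]
  refine liminf_le_liminf (Eventually.of_forall fun n => ?_)
  have hmeas : MeasurableSet (In z₀ n ∩ {z | r z = 1}) :=
    (measurableSet_In z₀ n).inter (hr_meas (measurableSet_singleton 1))
  have hrestrict : volume.restrict (Set.Icc (0 : ℝ) 1) (In z₀ n ∩ {z | r z = 1}) =
      volume (In z₀ n ∩ {z | r z = 1}) :=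
    Measure.restrict_eq_self _ (Set.inter_subset_left.trans (In_subset_Icc z₀ n))
  rw [setLIntegral_ofReal_fn_comp _ hr_meas hφ_meas hz₀, hu _ hmeas, div_eq_mul_inv,
    ← mul_assoc, mul_comm]
  gcongr
  rw [← hrestrict]
  exact mul_measure_le_setLIntegral huM _
end
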